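/- Fix y = (y₁,y₂) ∈ ℝ² with y₂ > 0 and vectors g, ν ∈ ℝ². Define u^{D,W}ᵢ(x) = Σⱼ Σₖ Tᴰᵢⱼₖ(x,y) νₖ gⱼ − Σⱼ Σₖ Tᴰᵢⱼₖ(x,yᴵ) νᴵₖ gᴵⱼ − [x₂ ∂φᴰ/∂xᵢ(x) − δᵢ₂ φᴰ(x)], where φᴰ(x) = −2 νᴵ₂ Gᴰ[gᴵ](x,yᴵ) + 2 gᴵ₂ Gᴰ[νᴵ](x,yᴵ) + 2 y₂ G^Q[νᴵ, gᴵ](x,yᴵ). Then u^{D,W} satisfies the no-slip condition: u^{D,W}ᵢ(x) = 0 for i = 1,2 and every x = (x₁,0) with x ≠ yᴵ. -/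

import Mathlib

open Real Finset

noncomputable section

/-- Points in two-dimensional Euclidean space. -/
abbrev E2 := EuclideanSpace ℝ (Fin 2)

/-- Partial derivative `∂f/∂xᵢ` of a scalar field on `ℝ²`. -/
def pd (i : Fin 2) (f : E2 → ℝ) (x : E2) : ℝ :=
  fderiv ℝ f x (EuclideanSpace.single i 1)

/-- Kronecker delta. -/
def kron (i j : Fin 2) : ℝ := if i = j then 1 else 0

/-- Reflected image point `yᴵ = (y₁, -y₂)`. -/
def reflPt (y : E2) : E2 := (EuclideanSpace.equiv (Fin 2) ℝ).symm ![y 0, -y 1]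

/-- Reflected vector `fᴵ = (f₁, -f₂)`. -/
def reflVec (f : Fin 2 → ℝ) : Fin 2 → ℝ := ![f 0, -f 1]

/-- Two-dimensional free-space Laplace Green's function `Gˢ(x,y) = -(1/2π) log|x-y|`. -/
def GS (x y : E2) : ℝ := -(1 / (2 * π)) * Real.log ‖x - y‖

/-- Two-dimensional dipole potential `Gᴰ[ν](x,y) = Σᵢ νᵢ ∂/∂yᵢ Gˢ(x,y)`. -/
def GD (ν : Fin 2 → ℝ) (x y : E2) : ℝ := ∑ i, ν i * pd i (fun z => GS x z) y

/-- Two-dimensional quadrupole potential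
`G^Q[ν,κ](x,y) = Σᵢ Σⱼ νᵢ κⱼ ∂²/∂yᵢ∂yⱼ Gˢ(x,y)`. -/
def GQ (ν κ : Fin 2 → ℝ) (x y : E2) : ℝ :=
  ∑ i, ∑ j, ν i * κ j * pd i (fun z => pd j (fun w => GS x w) z) y

/-- The two-dimensional Stokes doublet
`Tᴰᵢⱼₖ(x,y) = (1/2π)[-(xᵢ-yᵢ)δⱼₖ/|x-y|² - (xⱼ-yⱼ)δᵢₖ/|x-y|² + (xₖ-yₖ)δᵢⱼ/|x-y|²
  + 2(xᵢ-yᵢ)(xⱼ-yⱼ)(xₖ-yₖ)/|x-y|⁴]`. -/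
def TD2 (x y : E2) (i j k : Fin 2) : ℝ :=
  (1 / (2 * π)) * (-(x i - y i) * kron j k / ‖x - y‖ ^ 2
    - (x j - y j) * kron i k / ‖x - y‖ ^ 2
    + (x k - y k) * kron i j / ‖x - y‖ ^ 2
    + 2 * (x i - y i) * (x j - y j) * (x k - y k) / ‖x - y‖ ^ 4)

/-- The two-dimensional Papkovich–Neuber potential for the Stokes doublet image
system: `φᴰ(x) = -2 νᴵ₂ Gᴰ[gᴵ](x,yᴵ) + 2 gᴵ₂ Gᴰ[νᴵ](x,yᴵ) + 2 y₂ G^Q[νᴵ,gᴵ](x,yᴵ)`. -/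
def phiD2 (y : E2) (g ν : Fin 2 → ℝ) (x : E2) : ℝ :=
  -2 * reflVec ν 1 * GD (reflVec g) x (reflPt y)
    + 2 * reflVec g 1 * GD (reflVec ν) x (reflPt y)
    + 2 * y 1 * GQ (reflVec ν) (reflVec g) x (reflPt y)

/-- The half-plane Stokes doublet velocity `u^{D,W}`. -/
def uDW2 (y : E2) (g ν : Fin 2 → ℝ) (i : Fin 2) (x : E2) : ℝ :=
  (∑ j, ∑ k, TD2 x y i j k * ν k * g j)
    - (∑ j, ∑ k, TD2 x (reflPt y) i j k * reflVec ν k * reflVec g j)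
    - (x 1 * pd i (phiD2 y g ν) x - if i = 1 then phiD2 y g ν x else 0)

/-- Coordinate form of the Euclidean distance in the plane. -/
lemma norm_sub_sq_eq (x z : E2) : ‖x - z‖ ^ 2 = (x 0 - z 0) ^ 2 + (x 1 - z 1) ^ 2 := by
  simp [EuclideanSpace.norm_sq_eq, Fin.sum_univ_two]

lemma hasFDerivAt_coord_sub (x z : E2) (j : Fin 2) :
    HasFDerivAt (fun w : E2 => x j - w j) (-(EuclideanSpace.proj j : E2 →L[ℝ] ℝ)) z :=
  (EuclideanSpace.proj j : E2 →L[ℝ] ℝ).hasFDerivAt.const_sub (x j)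

lemma hasFDerivAt_norm_sub_sq (x z : E2) :
    HasFDerivAt (fun w : E2 => ‖x - w‖ ^ 2)
      ((2 * (x 0 - z 0)) • (-(EuclideanSpace.proj 0 : E2 →L[ℝ] ℝ)) +
        (2 * (x 1 - z 1)) • (-(EuclideanSpace.proj 1 : E2 →L[ℝ] ℝ))) z := by
  simp only [norm_sub_sq_eq]
  refine (((hasFDerivAt_coord_sub x z 0).pow 2).add
    ((hasFDerivAt_coord_sub x z 1).pow 2)).congr_fderiv ?_
  simp

lemma norm_sub_sq_ne_zero {x z : E2} (h : x ≠ z) : ‖x - z‖ ^ 2 ≠ 0 :=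
  pow_ne_zero 2 (norm_ne_zero_iff.mpr (sub_ne_zero.mpr h))

lemma GS_eq_log_sq (x z : E2) : GS x z = -(1 / (4 * π)) * Real.log (‖x - z‖ ^ 2) := by
  rw [GS, Real.log_pow]
  push_cast
  ring

/-- The gradient of the Laplace Green's function in the source variable. -/
lemma pd_GS {x z : E2} (h : x ≠ z) (j : Fin 2) :
    pd j (fun w => GS x w) z = 1 / (2 * π) * ((x j - z j) / ‖x - z‖ ^ 2) := by
  simp only [GS_eq_log_sq]
  rw [pd, (((hasFDerivAt_norm_sub_sq x z).log (norm_sub_sq_ne_zero h)).const_mul _).fderiv]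
  have := norm_sub_sq_ne_zero h
  fin_cases j <;> simp <;> field_simp <;> ring

/-- The Hessian of the Laplace Green's function in the source variable. -/
lemma pd_pd_GS {x z : E2} (h : x ≠ z) (i j : Fin 2) :
    pd i (fun v => pd j (fun w => GS x w) v) z =
      1 / (2 * π) * (-kron i j / ‖x - z‖ ^ 2
        + 2 * (x i - z i) * (x j - z j) / (‖x - z‖ ^ 2) ^ 2) := by
  have hne : ∀ᶠ v in nhds z, x ≠ v := by
    filter_upwards [isOpen_ne.mem_nhds h.symm] with v hv using hv.symm
  have heq : (fun v => pd j (fun w => GS x w) v) =ᶠ[nhds z]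
      fun v => 1 / (2 * π) * ((x j - v j) * (‖x - v‖ ^ 2)⁻¹) := by
    filter_upwards [hne] with v hv
    rw [pd_GS hv, div_eq_mul_inv (x j - v j)]
  have hρ := norm_sub_sq_ne_zero h
  have hinv := (hasDerivAt_inv hρ).comp_hasFDerivAt z (hasFDerivAt_norm_sub_sq x z)
  have hgrad : HasFDerivAt (fun v : E2 => 1 / (2 * π) * ((x j - v j) * (‖x - v‖ ^ 2)⁻¹)) _ z :=
    ((hasFDerivAt_coord_sub x z j).mul hinv).const_mul _
  rw [pd, heq.fderiv_eq, hgrad.fderiv]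
  fin_cases i <;> fin_cases j <;> simp [kron] <;> field_simp <;> ring

/-- the half-plane Stokes doublet `u^{D,W}` satisfies the no-slip
condition on the line `x₂ = 0`. -/
theorem stokes_doublet_halfplane_no_slip (y : E2) (hy : 0 < y 1) (g ν : Fin 2 → ℝ) :
    ∀ x : E2, x 1 = 0 → x ≠ reflPt y → ∀ i, uDW2 y g ν i x = 0 := by
  intro x hx hne i
  have hρ := norm_sub_sq_ne_zero hne
  have e0 : reflPt y 0 = y 0 := by simp [reflPt]
  have e1 : reflPt y 1 = -y 1 := by simp [reflPt]
  have hy_norm : ‖x - y‖ ^ 2 = ‖x - reflPt y‖ ^ 2 := by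
    rw [norm_sub_sq_eq, norm_sub_sq_eq, e0, e1, hx]
    ring
  have hpow (z : E2) : ‖x - z‖ ^ 4 = (‖x - z‖ ^ 2) ^ 2 := by ring
  simp only [uDW2, phiD2, TD2, GD, GQ, pd_GS hne, pd_pd_GS hne, Fin.sum_univ_two, hpow,
    hy_norm, e0, e1, hx]
  generalize ‖x - reflPt y‖ ^ 2 = ρ at hρ
  fin_cases i <;> simp [kron, reflVec, e0, e1, hx] <;> field_simp <;> ring
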